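/- Let A be a finite alphabet, let f₁, f₂ : A → A be involutions, and let ϑ₁, ϑ₂ be the involutory antimorphisms of A* determined by f₁ and f₂. Let n ≥ 0, let w = a₁a₂…a_n be a word over A with w = ϑ₁(w), and let a_{n+1} ∈ A. Then w·a_{n+1} = ϑ₂(w·a_{n+1}) if and only if a_{m+1} = (f₂∘f₁)^m(a₁) for every 0 ≤ m ≤ n (where (f₂∘f₁)^m is the m-fold iterate and a₁ denotes the first letter of w·a_{n+1}) and a_{n+1} = f₂(a₁). -/

import Mathlib

theorem reverse_map_eq_self_iff_getElem {A : Type*} (f : A → A) (v : List A) :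
    (v.map f).reverse = v ↔
      ∀ i (hi : i < v.length), v[i] = f (v[v.length - 1 - i]'(by omega)) := by
  constructor
  · intro h i hi
    have h' : v[i]? = (v.map f).reverse[i]? := by rw [h]
    rw [List.getElem?_eq_getElem hi, List.getElem?_eq_getElem (by simpa using hi)] at h'
    simpa using h'
  · intro h
    refine List.ext_getElem (by simp) fun i _ hi => ?_
    simpa using (h i hi).symm

/-- If `u 0, …, u (n - 1)` is an `f₁`-palindrome, then `u 0, …, u n` is an `f₂`-palindrome
iff it is an orbit segment of `f₂ ∘ f₁` whose last entry is `f₂ (u 0)`. -/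
theorem palindrome_iff_iterate {A : Type*} {f₁ f₂ : A → A} (h₁ : Function.Involutive f₁)
    (h₂ : Function.Involutive f₂) {n : ℕ} {u : ℕ → A}
    (hu : ∀ i < n, u i = f₁ (u (n - 1 - i))) :
    (∀ i < n + 1, u i = f₂ (u (n - i))) ↔
      (∀ m ≤ n, u m = (f₂ ∘ f₁)^[m] (u 0)) ∧ u n = f₂ (u 0) := by
  have hmirror : ∀ i < n, f₁ (u i) = u (n - (i + 1)) := fun i hi => by
    rw [hu i hi, h₁, Nat.sub_sub, Nat.add_comm]
  constructor
  · intro h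
    refine ⟨fun m => ?_, by simpa using h n n.lt_succ_self⟩
    induction m with
    | zero => simp
    | succ m ih =>
      intro hm
      rw [Function.iterate_succ_apply', ← ih (by omega), Function.comp_apply,
        hmirror m hm, ← h (m + 1) (by omega)]
  · rintro ⟨h, hn⟩ i hi
    cases i with
    | zero => rw [Nat.sub_zero, hn, h₂]
    | succ j =>
      rw [h (j + 1) (by omega), Function.iterate_succ_apply', ← h j (by omega),
        Function.comp_apply, hmirror j (by omega)]


/-- Lemma 17 (generalized): let `f₁, f₂` be involutions of a finite alphabet `A`
with associated involutory antimorphisms `ϑ₁ : v ↦ (v.map f₁).reverse` and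
`ϑ₂ : v ↦ (v.map f₂).reverse`, and let `w = a₁…a_n` be a `ϑ₁`-palindrome. Then
`w·a_{n+1}` is a `ϑ₂`-palindrome iff `a_{m+1} = (f₂ ∘ f₁)^m (a₁)` for all
`0 ≤ m ≤ n` and `a_{n+1} = f₂ (a₁)`. -/
theorem extension_palindrome_iff_iterate {A : Type*} [Fintype A]
    (f₁ f₂ : A → A) (h₁ : Function.Involutive f₁) (h₂ : Function.Involutive f₂)
    (n : ℕ) (w : List A) (hw : w.length = n)
    (hpal : (w.map f₁).reverse = w) (a : A) :
    ((w ++ [a]).map f₂).reverse = w ++ [a] ↔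
      ((∀ m : ℕ, (hm : m ≤ n) →
          (w ++ [a]).get ⟨m, by simpa [hw] using Nat.lt_succ_of_le hm⟩ =
            (f₂ ∘ f₁)^[m] ((w ++ [a]).get ⟨0, by simp⟩)) ∧
        a = f₂ ((w ++ [a]).get ⟨0, by simp⟩)) := by
  have hlen : (w ++ [a]).length = n + 1 := by simp [hw]
  have hget : ∀ i (hi : i < (w ++ [a]).length), (w ++ [a])[i] = (w ++ [a]).getD i a :=
    fun i hi => (List.getD_eq_getElem _ _ hi).symm
  have hlast : (w ++ [a]).getD n a = a := by simp [← hw]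
  have hu : ∀ i < n, (w ++ [a]).getD i a = f₁ ((w ++ [a]).getD (n - 1 - i) a) := by
    intro i hi
    have h := (reverse_map_eq_self_iff_getElem f₁ w).1 hpal i (by omega)
    rw [← hget i (by omega), ← hget (n - 1 - i) (by omega),
      List.getElem_append_left (by omega), List.getElem_append_left (by omega), h]
    simp only [hw]
  have key := palindrome_iff_iterate h₁ h₂ hu
  rw [hlast] at key
  rw [reverse_map_eq_self_iff_getElem]
  simp only [List.get_eq_getElem, hget, hlen, Nat.add_sub_cancel]
  exact key
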